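/- arXiv:2309.13530 — 2 statements merged into one kernel-verified Lean document; each statement's English description precedes it below -/
import Mathlib

section
/- Let T be a bounded operator on a complex Hilbert space H such that the operator algebra A_T admits a gauge action (γ_λ)_{λ∈𝕋}. If J is a nonzero closed two-sided ideal of A_T which is gauge invariant (i.e., γ_λ(S) ∈ J for every S ∈ J and λ ∈ 𝕋), then there exists a natural number n ≥ 1 such that J equals the smallest closed two-sided ideal of A_T containing T^n. -/
noncomputable section

variable {E : Type*} [NormedAddCommGroup E] [InnerProductSpace ℂ E] [CompleteSpace E]

/-- `A_T`: the operator-norm closure of the polynomials in `T` with zero constant term,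
i.e. the closed non-unital subalgebra of `B(E)` generated by `T`. -/
def polyAlg (T : E →L[ℂ] E) : Set (E →L[ℂ] E) :=
  closure ((NonUnitalAlgebra.adjoin ℂ {T} : NonUnitalSubalgebra ℂ (E →L[ℂ] E)) :
    Set (E →L[ℂ] E))

/-- A gauge action on `A_T`: a family `γ_λ` (for `λ` in the unit circle) of surjective
multiplicative linear isometries of `A_T` onto itself with `γ_λ ∘ γ_μ = γ_{λμ}`,
`γ_λ T = λ T`, and norm-continuity of `λ ↦ γ_λ S` for each `S ∈ A_T`. -/
structure GaugeAction (T : E →L[ℂ] E) where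
  γ : ℂ → (E →L[ℂ] E) → (E →L[ℂ] E)
  maps_to : ∀ l : ℂ, ‖l‖ = 1 → ∀ S ∈ polyAlg T, γ l S ∈ polyAlg T
  surj_on : ∀ l : ℂ, ‖l‖ = 1 → ∀ S ∈ polyAlg T, ∃ R ∈ polyAlg T, γ l R = S
  map_add : ∀ l : ℂ, ‖l‖ = 1 → ∀ S ∈ polyAlg T, ∀ R ∈ polyAlg T,
    γ l (S + R) = γ l S + γ l R
  map_smul : ∀ l : ℂ, ‖l‖ = 1 → ∀ c : ℂ, ∀ S ∈ polyAlg T, γ l (c • S) = c • γ l S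
  map_mul : ∀ l : ℂ, ‖l‖ = 1 → ∀ S ∈ polyAlg T, ∀ R ∈ polyAlg T,
    γ l (S * R) = γ l S * γ l R
  isometric : ∀ l : ℂ, ‖l‖ = 1 → ∀ S ∈ polyAlg T, ‖γ l S‖ = ‖S‖
  comp : ∀ l m : ℂ, ‖l‖ = 1 → ‖m‖ = 1 → ∀ S ∈ polyAlg T, γ l (γ m S) = γ (l * m) S
  map_gen : ∀ l : ℂ, ‖l‖ = 1 → γ l T = l • T
  cont : ∀ S ∈ polyAlg T, ContinuousOn (fun l => γ l S) {l : ℂ | ‖l‖ = 1}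

/-- A closed two-sided ideal of the (non-unital) operator algebra `A_T`. -/
def IsClosedIdeal (T : E →L[ℂ] E) (J : Set (E →L[ℂ] E)) : Prop :=
  J ⊆ polyAlg T ∧ IsClosed J ∧ (0 : E →L[ℂ] E) ∈ J ∧
  (∀ x ∈ J, ∀ y ∈ J, x + y ∈ J) ∧
  (∀ c : ℂ, ∀ x ∈ J, c • x ∈ J) ∧
  (∀ a ∈ polyAlg T, ∀ x ∈ J, a * x ∈ J ∧ x * a ∈ J)

/-- The smallest closed two-sided ideal of `A_T` containing `S`. -/
def idealGen (T S : E →L[ℂ] E) : Set (E →L[ℂ] E) :=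
  ⋂₀ {J : Set (E →L[ℂ] E) | IsClosedIdeal T J ∧ S ∈ J}

open MeasureTheory AddCircle in
lemma fourier_integrable_aux {V : Type*} [NormedAddCommGroup V] [NormedSpace ℂ V]
    {f : UnitAddCircle → V} (hf : Continuous f) (k : ℤ) :
    Integrable (fun t => fourier (-k) t • f t) (haarAddCircle (T := 1)) := by
  apply Continuous.integrable_of_hasCompactSupport
  · exact (map_continuous (fourier (-k))).smul hf
  · exact HasCompactSupport.of_compactSpace _

open MeasureTheory AddCircle in
lemma mem_of_fourierCoeff_mem {V : Type*} [NormedAddCommGroup V] [NormedSpace ℂ V]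
    [CompleteSpace V] (M : Submodule ℂ V) (hM : IsClosed (M : Set V))
    {f : UnitAddCircle → V} (hf : Continuous f)
    (h : ∀ k, fourierCoeff f k ∈ M) (t : UnitAddCircle) : f t ∈ M := by
  by_contra hx
  have hconv : Convex ℝ (M : Set V) := (M.restrictScalars ℝ).convex
  obtain ⟨φ, u, h1, h2⟩ := RCLike.geometric_hahn_banach_closed_point (𝕜 := ℂ) hconv hM hx
  have h0 : ∀ a ∈ M, φ a = 0 := by
    intro a ha
    by_contra hne
    have := h1 (((u : ℂ) / φ a) • a) (M.smul_mem _ ha)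
    simp [hne] at this
  have hu : 0 < u := by simpa using h1 0 M.zero_mem
  have hc : ∀ k, fourierCoeff (fun s => φ (f s)) k = 0 := by
    intro k
    rw [← h0 _ (h k), fourierCoeff, fourierCoeff,
      ← ContinuousLinearMap.integral_comp_comm φ (fourier_integrable_aux hf k)]
    simp
  let g : C(UnitAddCircle, ℂ) := ⟨fun s => φ (f s), φ.continuous.comp hf⟩
  have hg : fourierCoeff g = 0 := funext hc
  have hs := has_pointwise_sum_fourier_series_of_summable (f := g)
    (by rw [hg]; exact summable_zero) t
  have h3 : g t = 0 := by
    refine hs.unique ?_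
    rw [hg]
    simpa using (hasSum_zero : HasSum (fun _ : ℤ => (0 : ℂ)) 0)
  have h4 : φ (f t) = 0 := h3
  rw [h4] at h2
  simp at h2
  linarith

open MeasureTheory AddCircle in
lemma fourierCoeff_mem_of_mem {V : Type*} [NormedAddCommGroup V] [NormedSpace ℂ V]
    [CompleteSpace V] (M : Submodule ℂ V) (hM : IsClosed (M : Set V))
    {f : UnitAddCircle → V} (hf : Continuous f)
    (h : ∀ t, f t ∈ M) (k : ℤ) : fourierCoeff f k ∈ M := by
  have hconv : Convex ℝ (M : Set V) := (M.restrictScalars ℝ).convex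
  exact hconv.integral_mem hM (Filter.Eventually.of_forall fun t => M.smul_mem _ (h t))
    (fourier_integrable_aux hf k)

lemma pow_mem_polyAlg (T : E →L[ℂ] E) (j : ℕ) : T ^ (j + 1) ∈ polyAlg T := by
  apply subset_closure
  induction j with
  | zero => simpa using NonUnitalAlgebra.self_mem_adjoin_singleton ℂ T
  | succ j ih =>
    rw [pow_succ]
    exact mul_mem ih (NonUnitalAlgebra.self_mem_adjoin_singleton ℂ T)

/-- `A_T` as a submodule. -/
def polyMod (T : E →L[ℂ] E) : Submodule ℂ (E →L[ℂ] E) :=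
  (NonUnitalAlgebra.adjoin ℂ {T} : NonUnitalSubalgebra ℂ (E →L[ℂ] E)).toSubmodule.topologicalClosure

lemma mem_polyMod (T S : E →L[ℂ] E) : S ∈ polyMod T ↔ S ∈ polyAlg T := Iff.rfl

lemma mul_mem_polyAlg (T : E →L[ℂ] E) {a b} (ha : a ∈ polyAlg T) (hb : b ∈ polyAlg T) :
    a * b ∈ polyAlg T :=
  mul_mem (S := NonUnitalSubalgebra ℂ (E →L[ℂ] E))
    (s := (NonUnitalAlgebra.adjoin ℂ {T}).topologicalClosure) ha hb

lemma adjoin_le_span (T : E →L[ℂ] E) :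
    (NonUnitalAlgebra.adjoin ℂ {T} : NonUnitalSubalgebra ℂ (E →L[ℂ] E)).toSubmodule ≤
      Submodule.span ℂ (Set.range fun j : ℕ => T ^ (j + 1)) := by
  rw [NonUnitalAlgebra.adjoin_eq_span]
  apply Submodule.span_mono
  intro x hx
  induction hx using Subsemigroup.closure_induction with
  | mem x hx => exact ⟨0, by simpa using hx.symm⟩
  | mul x y _ _ hx hy =>
    obtain ⟨i, rfl⟩ := hx
    obtain ⟨j, rfl⟩ := hy
    exact ⟨i + j + 1, by simp only [← pow_add]; congr 1; ring⟩

/-- the orbit map of `S` -/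
def orb {T : E →L[ℂ] E} (G : GaugeAction T) (S : E →L[ℂ] E) (t : UnitAddCircle) : E →L[ℂ] E :=
  G.γ (AddCircle.toCircle t : ℂ) S

lemma orb_cont {T : E →L[ℂ] E} (G : GaugeAction T) {S} (hS : S ∈ polyAlg T) :
    Continuous (orb G S) :=
  (G.cont S hS).comp_continuous (continuous_subtype_val.comp AddCircle.continuous_toCircle)
    (fun t => Circle.norm_coe _)

lemma gamma_pow {T : E →L[ℂ] E} (G : GaugeAction T) (l : ℂ) (hl : ‖l‖ = 1) (j : ℕ) :
    G.γ l (T ^ (j + 1)) = l ^ (j + 1) • T ^ (j + 1) := by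
  induction j with
  | zero => simpa using G.map_gen l hl
  | succ j ih =>
    rw [pow_succ, G.map_mul l hl _ (pow_mem_polyAlg T j) _ (by simpa using pow_mem_polyAlg T 0),
      ih, G.map_gen l hl, smul_mul_smul_comm]
    rw [← pow_succ]

/-- the `k`-th homogeneous component -/
def comp (T : E →L[ℂ] E) (k : ℤ) : Submodule ℂ (E →L[ℂ] E) :=
  Submodule.span ℂ {x | ∃ j : ℕ, ((j + 1 : ℕ) : ℤ) = k ∧ x = T ^ (j + 1)}

lemma comp_closed (T : E →L[ℂ] E) (k : ℤ) : IsClosed (comp T k : Set (E →L[ℂ] E)) := by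
  have hfin : {x | ∃ j : ℕ, ((j + 1 : ℕ) : ℤ) = k ∧ x = T ^ (j + 1)}.Finite := by
    apply Set.Subsingleton.finite
    rintro _ ⟨i, hi, rfl⟩ _ ⟨j, hj, rfl⟩
    have : i = j := by omega
    rw [this]
  have : FiniteDimensional ℂ (comp T k) := FiniteDimensional.span_of_finite ℂ hfin
  exact Submodule.closed_of_finiteDimensional _

lemma coeff_pow {T : E →L[ℂ] E} (G : GaugeAction T) (j : ℕ) (k : ℤ) :
    fourierCoeff (orb G (T ^ (j + 1))) k ∈ comp T k := by
  have h1 : fourierCoeff (orb G (T ^ (j + 1))) k =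
      fourierCoeff (T := 1) (fourier ((j + 1 : ℕ) : ℤ)) k • T ^ (j + 1) := by
    rw [fourierCoeff, fourierCoeff, ← integral_smul_const]
    congr 1
    ext1 t
    rw [orb, gamma_pow G _ (Circle.norm_coe _), smul_smul, smul_eq_mul]
    congr 2
    rw [fourier_apply, natCast_zsmul, AddCircle.toCircle_nsmul]
    simp
  rw [h1, fourierCoeff_fourier]
  by_cases h : ((j + 1 : ℕ) : ℤ) = k
  · exact Submodule.smul_mem _ _ (Submodule.subset_span ⟨j, h, rfl⟩)
  · rw [Pi.single_apply, if_neg (Ne.symm h)]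
    simp

lemma span_le_polyMod (T : E →L[ℂ] E) :
    Submodule.span ℂ (Set.range fun j : ℕ => T ^ (j + 1)) ≤ polyMod T := by
  rw [Submodule.span_le]
  rintro _ ⟨j, rfl⟩
  exact pow_mem_polyAlg T j

lemma orb_add {T : E →L[ℂ] E} (G : GaugeAction T) {S R} (hS : S ∈ polyAlg T)
    (hR : R ∈ polyAlg T) : orb G (S + R) = orb G S + orb G R :=
  funext fun t => G.map_add _ (Circle.norm_coe _) S hS R hR

lemma orb_smul {T : E →L[ℂ] E} (G : GaugeAction T) (c : ℂ) {S} (hS : S ∈ polyAlg T) :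
    orb G (c • S) = c • orb G S :=
  funext fun t => G.map_smul _ (Circle.norm_coe _) c S hS

open MeasureTheory AddCircle in
lemma orb_integrable {T : E →L[ℂ] E} (G : GaugeAction T) {S} (hS : S ∈ polyAlg T) :
    Integrable (orb G S) (haarAddCircle (T := 1)) := by
  simpa using fourier_integrable_aux (orb_cont G hS) 0

lemma coeff_add {T : E →L[ℂ] E} (G : GaugeAction T) {S R} (hS : S ∈ polyAlg T)
    (hR : R ∈ polyAlg T) (k : ℤ) : fourierCoeff (orb G (S + R)) k =
      fourierCoeff (orb G S) k + fourierCoeff (orb G R) k := by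
  rw [orb_add G hS hR, fourierCoeff.add (orb_integrable G hS) (orb_integrable G hR)]
  rfl

lemma coeff_smul {T : E →L[ℂ] E} (G : GaugeAction T) (c : ℂ) {S} (hS : S ∈ polyAlg T)
    (k : ℤ) : fourierCoeff (orb G (c • S)) k = c • fourierCoeff (orb G S) k := by
  rw [orb_smul G c hS, fourierCoeff.const_smul]

lemma coeff_span {T : E →L[ℂ] E} (G : GaugeAction T) (k : ℤ) {S}
    (hS : S ∈ Submodule.span ℂ (Set.range fun j : ℕ => T ^ (j + 1))) :
    fourierCoeff (orb G S) k ∈ comp T k := by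
  induction hS using Submodule.span_induction with
  | mem x hx => obtain ⟨j, rfl⟩ := hx; exact coeff_pow G j k
  | zero =>
    have := coeff_smul G 0 (pow_mem_polyAlg T 0) k
    rw [zero_smul, zero_smul] at this
    rw [this]; exact zero_mem _
  | add x y hx hy ihx ihy =>
    rw [coeff_add G (span_le_polyMod T hx) (span_le_polyMod T hy)]
    exact add_mem ihx ihy
  | smul c x hx ih =>
    rw [coeff_smul G c (span_le_polyMod T hx)]
    exact Submodule.smul_mem _ _ ih

lemma coeff_norm_le {T : E →L[ℂ] E} (G : GaugeAction T) (k : ℤ) {S} (hS : S ∈ polyAlg T) :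
    ‖fourierCoeff (orb G S) k‖ ≤ ‖S‖ := by
  rw [fourierCoeff]
  refine (MeasureTheory.norm_integral_le_of_norm_le_const (C := ‖S‖)
    (Filter.Eventually.of_forall fun t => ?_)).trans ?_
  · rw [norm_smul, orb, G.isometric _ (Circle.norm_coe _) S hS, fourier_apply]
    exact (by rw [Circle.norm_coe, one_mul] : ‖(AddCircle.toCircle (-k • t) : ℂ)‖ * ‖S‖ = ‖S‖).le
  · simp

lemma coeff_mem {T : E →L[ℂ] E} (G : GaugeAction T) (k : ℤ) {S} (hS : S ∈ polyAlg T) :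
    fourierCoeff (orb G S) k ∈ comp T k := by
  rw [← SetLike.mem_coe, ← (comp_closed T k).closure_eq, Metric.mem_closure_iff]
  intro ε hε
  obtain ⟨P, hP, hd⟩ := Metric.mem_closure_iff.1 hS ε hε
  have hP' := adjoin_le_span T hP
  have hPA : P ∈ polyAlg T := subset_closure hP
  refine ⟨_, coeff_span G k hP', lt_of_le_of_lt ?_ hd⟩
  have hneg : (-1 : ℂ) • P ∈ polyAlg T := (polyMod T).smul_mem _ hPA
  have hsub := coeff_norm_le G k (show S + (-1 : ℂ) • P ∈ polyAlg T from
    (polyMod T).add_mem hS hneg)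
  rw [coeff_add G hS hneg, coeff_smul G _ hPA] at hsub
  simpa [dist_eq_norm, sub_eq_add_neg] using hsub

lemma orb_zero {T : E →L[ℂ] E} (G : GaugeAction T) {S} (hS : S ∈ polyAlg T) :
    orb G S 0 = S := by
  have h1 : orb G S 0 = G.γ 1 S := by simp [orb]
  rw [h1]
  have hm := G.maps_to 1 (by simp) S hS
  have hneg : (-1 : ℂ) • S ∈ polyAlg T := (polyMod T).smul_mem _ hS
  have h2 := G.isometric 1 (by simp) (G.γ 1 S + (-1 : ℂ) • S) ((polyMod T).add_mem hm hneg)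
  rw [G.map_add 1 (by simp) _ hm _ hneg, G.map_smul 1 (by simp) _ _ hS,
    G.comp 1 1 (by simp) (by simp) S hS] at h2
  simp only [mul_one, neg_smul, one_smul, add_neg_cancel, norm_zero] at h2
  exact add_neg_eq_zero.1 (norm_eq_zero.1 h2.symm)

/-- A closed ideal as a submodule. -/
def IsClosedIdeal.toMod {T : E →L[ℂ] E} {J : Set (E →L[ℂ] E)} (h : IsClosedIdeal T J) :
    Submodule ℂ (E →L[ℂ] E) where
  carrier := J
  zero_mem' := h.2.2.1
  add_mem' := fun hx hy => h.2.2.2.1 _ hx _ hy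
  smul_mem' := fun c _ hx => h.2.2.2.2.1 c _ hx

lemma mem_of_pow_mem {T : E →L[ℂ] E} (G : GaugeAction T)
    {J : Set (E →L[ℂ] E)} (hJ : IsClosedIdeal T J)
    (hinv : ∀ l : ℂ, ‖l‖ = 1 → ∀ S ∈ J, G.γ l S ∈ J)
    (M : Submodule ℂ (E →L[ℂ] E)) (hM : IsClosed (M : Set (E →L[ℂ] E)))
    (h : ∀ j : ℕ, T ^ (j + 1) ∈ J → T ^ (j + 1) ∈ M) {S} (hS : S ∈ J) : S ∈ M := by
  have hSA := hJ.1 hS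
  rw [← orb_zero G hSA]
  refine mem_of_fourierCoeff_mem M hM (orb_cont G hSA) (fun k => ?_) 0
  have h1 : fourierCoeff (orb G S) k ∈ hJ.toMod :=
    fourierCoeff_mem_of_mem hJ.toMod hJ.2.1 (orb_cont G hSA)
      (fun t => hinv _ (Circle.norm_coe _) S hS) k
  have h2 := coeff_mem G k hSA
  by_cases hk : ∃ j : ℕ, ((j + 1 : ℕ) : ℤ) = k
  · obtain ⟨j, hj⟩ := hk
    have h3 : comp T k ≤ Submodule.span ℂ {T ^ (j + 1)} := by
      apply Submodule.span_mono
      rintro _ ⟨i, hi, rfl⟩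
      have : i = j := by omega
      rw [this]; rfl
    obtain ⟨c, hc⟩ := Submodule.mem_span_singleton.1 (h3 h2)
    rw [← hc] at h1 ⊢
    by_cases hc0 : c = 0
    · rw [hc0, zero_smul]; exact zero_mem _
    · exact M.smul_mem _ (h j ((Submodule.smul_mem_iff _ hc0).1 h1))
  · have h3 : comp T k ≤ ⊥ := by
      apply Submodule.span_le.2
      rintro _ ⟨i, hi, rfl⟩
      exact absurd ⟨i, hi⟩ hk
    rw [(Submodule.mem_bot ℂ).1 (h3 h2)]
    exact zero_mem _

/-- If `A_T` admits a gauge action and `J` is a nonzero gauge-invariant closed two-sided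
ideal of `A_T`, then `J = <T^n>` for some `n ≥ 1`. -/
theorem gauge_invariant_ideal (T : E →L[ℂ] E) (G : GaugeAction T)
    (J : Set (E →L[ℂ] E)) (hJ : IsClosedIdeal T J) (hJ0 : J ≠ {0})
    (hinv : ∀ l : ℂ, ‖l‖ = 1 → ∀ S ∈ J, G.γ l S ∈ J) :
    ∃ n : ℕ, 1 ≤ n ∧ J = idealGen T (T ^ n) := by
  classical
  have hex : ∃ j : ℕ, T ^ (j + 1) ∈ J := by
    by_contra hno
    push Not at hno
    apply hJ0
    ext S
    refine ⟨fun hS => ?_, fun hS => ?_⟩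
    · have := mem_of_pow_mem G hJ hinv ⊥ (by simp) (fun j hj => absurd hj (hno j)) hS
      simpa using this
    · rw [Set.mem_singleton_iff.1 hS]; exact hJ.2.2.1
  obtain ⟨hn, hmin⟩ := And.intro (Nat.find_spec hex) (fun j => Nat.find_min' hex (m := j))
  set n := Nat.find hex
  refine ⟨n + 1, by omega, Set.Subset.antisymm ?_ ?_⟩
  · intro S hS K hK
    refine mem_of_pow_mem G hJ hinv hK.1.toMod hK.1.2.1 (fun j hj => ?_) hS
    obtain ⟨d, rfl⟩ := Nat.exists_eq_add_of_le (hmin j hj)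
    rcases d with _ | d
    · exact hK.2
    · have := (hK.1.2.2.2.2.2 _ (pow_mem_polyAlg T d) _ hK.2).1
      rw [← pow_add] at this
      have he : n + (d + 1) + 1 = d + 1 + (n + 1) := by ring
      rw [he]
      exact this
  · exact Set.sInter_subset_of_mem ⟨hJ, hn⟩
end
end

section
/- The nilpotent elements are dense in the Volterra operator algebra A_V: for every S ∈ A_V and every ε > 0 there exist N ∈ A_V and n ≥ 1 with N^n = 0 and ‖S − N‖ < ε. -/
open MeasureTheory
open scoped ENNReal

noncomputable section

/-- Lebesgue measure restricted to `[0,1]`. -/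
def μ01 : Measure ℝ := volume.restrict (Set.Icc (0:ℝ) 1)

/-- `L²([0,1])` over `ℂ`. -/
abbrev L2 : Type := Lp ℂ 2 μ01

/-- `A_V`: the operator-norm closure of the polynomials in `V` with zero constant term. -/
def polyAlgV (V : L2 →L[ℂ] L2) : Set (L2 →L[ℂ] L2) :=
  closure ((NonUnitalAlgebra.adjoin ℂ {V} : NonUnitalSubalgebra ℂ (L2 →L[ℂ] L2)) :
    Set (L2 →L[ℂ] L2))

instance : IsProbabilityMeasure μ01 := ⟨by simp [μ01]⟩

/-- The Volterra convolution kernel attached to `k`. -/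
def KK (k : ℝ → ℝ) (x t : ℝ) : ℂ := if t ≤ x then (k (x - t) : ℂ) else 0

/-- `T` is the convolution operator with kernel `k`. -/
def IsC (T : L2 →L[ℂ] L2) (k : ℝ → ℝ) : Prop :=
  ∀ f : L2, ∀ᵐ x ∂μ01, T f x = ∫ t, KK k x t * f t ∂μ01

lemma ae_mem01 : ∀ᵐ x ∂μ01, x ∈ Set.Icc (0:ℝ) 1 := ae_restrict_mem measurableSet_Icc

lemma L2_int (f : L2) : Integrable f μ01 := (Lp.memLp f).integrable one_le_two

lemma KK_meas {k : ℝ → ℝ} (hk : Continuous k) : Measurable (Function.uncurry (KK k)) := by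
  unfold Function.uncurry KK
  refine Measurable.ite (measurableSet_le measurable_snd measurable_fst) ?_ measurable_const
  fun_prop

lemma KK_meas1 {k : ℝ → ℝ} (hk : Continuous k) (x : ℝ) : Measurable (KK k x) :=
  (KK_meas hk).comp (measurable_const.prodMk measurable_id)

lemma KK_bd_of {k : ℝ → ℝ} {M : ℝ} (hM : ∀ u ∈ Set.Icc (0:ℝ) 1, |k u| ≤ M) :
    ∀ x ∈ Set.Icc (0:ℝ) 1, ∀ t ∈ Set.Icc (0:ℝ) 1, ‖KK k x t‖ ≤ M := by
  intro x hx t ht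
  have h0 : 0 ≤ M := (abs_nonneg _).trans (hM 0 (by simp))
  unfold KK
  split_ifs with h
  · rw [Complex.norm_real]
    exact hM _ ⟨by linarith, by linarith [hx.2, ht.1]⟩
  · simpa using h0

lemma KK_bd {k : ℝ → ℝ} (hk : Continuous k) :
    ∃ M : ℝ, ∀ u ∈ Set.Icc (0:ℝ) 1, |k u| ≤ M := by
  obtain ⟨M, hM⟩ := isCompact_Icc.exists_bound_of_continuousOn (s := Set.Icc (0:ℝ) 1)
    hk.continuousOn
  exact ⟨M, hM⟩

lemma KK_int {k : ℝ → ℝ} (hk : Continuous k) {x : ℝ} (hx : x ∈ Set.Icc (0:ℝ) 1) (f : L2) :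
    Integrable (fun t => KK k x t * f t) μ01 := by
  obtain ⟨M, hM⟩ := KK_bd hk
  refine (L2_int f).bdd_mul (c := M) (KK_meas1 hk x).aestronglyMeasurable ?_
  filter_upwards [ae_mem01] with t ht using KK_bd_of hM x hx t ht

lemma KK_memLp {k : ℝ → ℝ} (hk : Continuous k) {x : ℝ} (hx : x ∈ Set.Icc (0:ℝ) 1) :
    MemLp (KK k x) 2 μ01 := by
  obtain ⟨M, hM⟩ := KK_bd hk
  refine MemLp.of_bound (KK_meas1 hk x).aestronglyMeasurable M ?_
  filter_upwards [ae_mem01] with t ht using KK_bd_of hM x hx t ht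

lemma cs_bound {g : ℝ → ℂ} (hg : MemLp g 2 μ01) {c : ℝ} (hc : 0 ≤ c)
    (h : ∫ t, ‖g t‖ ^ 2 ∂μ01 ≤ c ^ 2) (f : L2) : ‖∫ t, g t * f t ∂μ01‖ ≤ c * ‖f‖ := by
  have hg' : MemLp (fun t => star (g t)) 2 μ01 := hg.star
  set G : L2 := hg'.toLp _ with hG
  have h1 : ∫ t, g t * f t ∂μ01 = inner ℂ G f := by
    rw [L2.inner_def]
    refine integral_congr_ae ?_
    filter_upwards [hg'.coeFn_toLp] with t ht
    rw [hG, ht]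
    simp [mul_comm]
  have h2 : ‖G‖ ^ 2 ≤ c ^ 2 := by
    refine le_trans (le_of_eq ?_) h
    rw [← inner_self_eq_norm_sq (𝕜 := ℂ), L2.inner_def]
    have : ∫ t, inner ℂ (G t) (G t) ∂μ01 = ∫ t, ((‖g t‖ ^ 2 : ℝ) : ℂ) ∂μ01 := by
      refine integral_congr_ae ?_
      filter_upwards [hg'.coeFn_toLp] with t ht
      rw [hG, ht, inner_self_eq_norm_sq_to_K]
      simp
    rw [this, integral_complex_ofReal]
    simp
  rw [h1]
  refine (norm_inner_le_norm _ _).trans ?_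
  gcongr
  exact abs_le_of_sq_le_sq' h2 hc |>.2

lemma L2_norm_le {f : L2} {C : ℝ} (hC : 0 ≤ C) (h : ∀ᵐ x ∂μ01, ‖f x‖ ≤ C) : ‖f‖ ≤ C := by
  have := Lp.norm_le_of_ae_bound hC h
  simpa [measureUnivNNReal] using this

lemma IsC.norm_le {T : L2 →L[ℂ] L2} {k : ℝ → ℝ} (hT : IsC T k) (hk : Continuous k) {c : ℝ}
    (hc : 0 ≤ c) (h : ∀ x ∈ Set.Icc (0:ℝ) 1, ∫ t, ‖KK k x t‖ ^ 2 ∂μ01 ≤ c ^ 2) : ‖T‖ ≤ c := by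
  refine T.opNorm_le_bound hc fun f => L2_norm_le (by positivity) ?_
  filter_upwards [hT f, ae_mem01] with x hx hx1
  rw [hx]
  exact cs_bound (KK_memLp hk hx1) hc (h x hx1) f

lemma IsC.norm_le' {T : L2 →L[ℂ] L2} {k : ℝ → ℝ} (hT : IsC T k) (hk : Continuous k) {c : ℝ}
    (h : ∀ u ∈ Set.Icc (0:ℝ) 1, |k u| ≤ c) : ‖T‖ ≤ c := by
  have hc : 0 ≤ c := (abs_nonneg _).trans (h 0 (by simp))
  refine hT.norm_le hk hc fun x hx => ?_
  calc ∫ t, ‖KK k x t‖ ^ 2 ∂μ01 ≤ ∫ t, c ^ 2 ∂μ01 := by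
        refine integral_mono_of_nonneg (ae_of_all _ fun _ => by positivity)
          (integrable_const _) ?_
        filter_upwards [ae_mem01] with t ht
        have := KK_bd_of h x hx t ht
        gcongr
    _ = c ^ 2 := by simp

lemma exists_IsC {k : ℝ → ℝ} (hk : Continuous k) : ∃ T, IsC T k := by
  obtain ⟨M, hM⟩ := KK_bd hk
  have hM0 : 0 ≤ M := (abs_nonneg _).trans (hM 0 (by simp))
  have hb : ∀ f : L2, ∀ x ∈ Set.Icc (0:ℝ) 1, ‖∫ t, KK k x t * f t ∂μ01‖ ≤ M * ‖f‖ := by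
    intro f x hx
    refine cs_bound (KK_memLp hk hx) hM0 ?_ f
    calc ∫ t, ‖KK k x t‖ ^ 2 ∂μ01 ≤ ∫ t, M ^ 2 ∂μ01 := by
          refine integral_mono_of_nonneg (ae_of_all _ fun _ => by positivity)
            (integrable_const _) ?_
          filter_upwards [ae_mem01] with t ht
          have := KK_bd_of hM x hx t ht
          gcongr
      _ = M ^ 2 := by simp
  have hm : ∀ f : L2, MemLp (fun x => ∫ t, KK k x t * f t ∂μ01) 2 μ01 := by
    intro f
    refine MemLp.of_bound (C := M * ‖f‖) ?_ ?_
    · have : AEStronglyMeasurable (fun p : ℝ × ℝ => KK k p.1 p.2 * f p.2) (μ01.prod μ01) :=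
        (KK_meas hk).aestronglyMeasurable.mul
          (Lp.aestronglyMeasurable f).comp_snd
      exact this.integral_prod_right'
    · filter_upwards [ae_mem01] with x hx using hb f x hx
  let L : L2 →ₗ[ℂ] L2 :=
    { toFun := fun f => (hm f).toLp _
      map_add' := by
        intro f g
        apply Lp.ext
        filter_upwards [(hm (f + g)).coeFn_toLp, (hm f).coeFn_toLp, (hm g).coeFn_toLp,
          Lp.coeFn_add ((hm f).toLp _) ((hm g).toLp _), ae_mem01] with x h1 h2 h3 h4 hx
        rw [h1, h4, Pi.add_apply, h2, h3, ← integral_add (KK_int hk hx f) (KK_int hk hx g)]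
        refine integral_congr_ae ?_
        filter_upwards [Lp.coeFn_add f g] with t ht
        rw [ht, Pi.add_apply, mul_add]
      map_smul' := by
        intro c f
        apply Lp.ext
        filter_upwards [(hm (c • f)).coeFn_toLp, (hm f).coeFn_toLp,
          Lp.coeFn_smul c ((hm f).toLp _)] with x h1 h2 h3
        rw [h1, RingHom.id_apply, h3, Pi.smul_apply, h2, smul_eq_mul, ← integral_const_mul]
        refine integral_congr_ae ?_
        filter_upwards [Lp.coeFn_smul c f] with t ht
        rw [ht, Pi.smul_apply, smul_eq_mul]
        ring }
  refine ⟨L.mkContinuous M fun f => L2_norm_le (by positivity) ?_, fun f => ?_⟩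
  · filter_upwards [(hm f).coeFn_toLp, ae_mem01] with x h1 hx
    change ‖(hm f).toLp _ x‖ ≤ _
    rw [h1]
    exact hb f x hx
  · exact (hm f).coeFn_toLp

lemma IsC.add {S T : L2 →L[ℂ] L2} {k l : ℝ → ℝ} (hS : IsC S k) (hT : IsC T l)
    (hk : Continuous k) (hl : Continuous l) : IsC (S + T) (fun u => k u + l u) := by
  intro f
  filter_upwards [hS f, hT f, Lp.coeFn_add (S f) (T f), ae_mem01] with x h1 h2 h3 hx
  rw [add_apply, h3, Pi.add_apply, h1, h2,
    ← integral_add (KK_int hk hx f) (KK_int hl hx f)]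
  congr 1
  ext t
  simp only [KK]
  split_ifs <;> push_cast <;> ring

lemma IsC.smul {S : L2 →L[ℂ] L2} {k : ℝ → ℝ} (hS : IsC S k) (c : ℝ) :
    IsC ((c : ℂ) • S) (fun u => c * k u) := by
  intro f
  filter_upwards [hS f, Lp.coeFn_smul (c : ℂ) (S f)] with x h1 h2
  rw [smul_apply, h2, Pi.smul_apply, h1, smul_eq_mul, ← integral_const_mul]
  congr 1
  ext t
  simp only [KK]
  split_ifs <;> push_cast <;> ring

lemma IsC.sub {S T : L2 →L[ℂ] L2} {k l : ℝ → ℝ} (hS : IsC S k) (hT : IsC T l)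
    (hk : Continuous k) (hl : Continuous l) : IsC (S - T) (fun u => k u - l u) := by
  have := hS.add (hT.smul (-1)) hk (by fun_prop)
  convert this using 1
  · ext1 f; simp [sub_eq_add_neg]
  · ext u; ring

lemma setInt01 {g : ℝ → ℂ} {a b : ℝ} (ha : 0 ≤ a) (hab : a ≤ b) (hb : b ≤ 1) :
    ∫ s, (if a ≤ s ∧ s ≤ b then g s else 0) ∂μ01 = ∫ s in a..b, g s := by
  have h1 : (fun s => if a ≤ s ∧ s ≤ b then g s else 0) = (Set.Icc a b).indicator g := by
    ext s; simp [Set.indicator, Set.mem_Icc]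
  rw [h1, μ01, integral_indicator measurableSet_Icc, Measure.restrict_restrict measurableSet_Icc,
    Set.inter_eq_left.2 (Set.Icc_subset_Icc ha hb), intervalIntegral.integral_of_le hab,
    integral_Icc_eq_integral_Ioc]

lemma isC_V {V : L2 →L[ℂ] L2}
    (hV : ∀ ρ : L2, ∀ᵐ x ∂μ01, (V ρ) x = ∫ t in (0:ℝ)..x, ρ t) : IsC V (fun _ => 1) := by
  intro f
  filter_upwards [hV f, ae_mem01] with x h1 hx
  rw [h1, ← setInt01 le_rfl hx.1 hx.2]
  refine integral_congr_ae ?_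
  filter_upwards [ae_mem01] with t ht
  simp [KK, ht.1]

lemma IsC.comp_V {V T : L2 →L[ℂ] L2} {k : ℝ → ℝ} (hV : IsC V (fun _ => 1)) (hT : IsC T k)
    (hk : Continuous k) : IsC (V * T) (fun u => ∫ v in (0:ℝ)..u, k v) := by
  intro f
  obtain ⟨M, hM⟩ := KK_bd hk
  filter_upwards [hV (T f), ae_mem01] with x h1 hx
  rw [mul_apply_eq_comp, h1]
  have h2 : ∫ s, KK (fun _ => 1) x s * (T f) s ∂μ01
      = ∫ s, ∫ t, KK (fun _ => 1) x s * KK k s t * f t ∂μ01 ∂μ01 := by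
    refine integral_congr_ae ?_
    filter_upwards [hT f] with s hs
    rw [hs, ← integral_const_mul]
    simp only [mul_assoc]
  rw [h2, integral_integral_swap]
  · refine integral_congr_ae ?_
    filter_upwards [ae_mem01] with t ht
    rw [integral_mul_const]
    congr 1
    have h3 : (fun s => KK (fun _ => 1) x s * KK k s t)
        = fun s => if t ≤ s ∧ s ≤ x then ((k (s - t) : ℝ) : ℂ) else 0 := by
      ext s
      simp only [KK]
      split_ifs <;> simp_all
    rw [h3]
    by_cases htx : t ≤ x
    · rw [setInt01 ht.1 htx hx.2]
      simp only [KK, if_pos htx]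
      rw [intervalIntegral.integral_ofReal, intervalIntegral.integral_comp_sub_right, sub_self]
    · have : ∀ s, ¬ (t ≤ s ∧ s ≤ x) := fun s hs => htx (hs.1.trans hs.2)
      simp [KK, htx, this]
  · refine Integrable.bdd_mul (c := M) ((L2_int f).comp_snd μ01)
      (f := fun p : ℝ × ℝ => KK (fun _ => 1) x p.1 * KK k p.1 p.2) ?_ ?_
    · exact (((KK_meas1 continuous_const x).comp measurable_fst).mul
        (KK_meas hk)).aestronglyMeasurable
    · have h5 : ∀ᵐ p ∂(μ01.prod μ01), p.1 ∈ Set.Icc (0:ℝ) 1 :=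
        Measure.quasiMeasurePreserving_fst.ae ae_mem01
      have h6 : ∀ᵐ p ∂(μ01.prod μ01), p.2 ∈ Set.Icc (0:ℝ) 1 :=
        Measure.quasiMeasurePreserving_snd.ae ae_mem01
      filter_upwards [h5, h6] with p hp1 hp2
      rw [norm_mul]
      have e1 := KK_bd_of (k := fun _ => 1) (M := 1) (by simp) x hx p.1 hp1
      have e2 := KK_bd_of hM p.1 hp1 p.2 hp2
      calc _ ≤ 1 * M := mul_le_mul e1 e2 (norm_nonneg _) zero_le_one
        _ = M := one_mul M

lemma isC_pow {V : L2 →L[ℂ] L2} (hV : IsC V (fun _ => 1)) (n : ℕ) :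
    ∃ T ∈ NonUnitalAlgebra.adjoin ℂ {V}, IsC T (fun u => u ^ n) := by
  induction n with
  | zero => exact ⟨V, NonUnitalAlgebra.subset_adjoin ℂ rfl, by simpa using hV⟩
  | succ n ih =>
    obtain ⟨T, hT, hTc⟩ := ih
    refine ⟨(((n + 1 : ℝ)) : ℂ) • (V * T), SMulMemClass.smul_mem _
      (mul_mem (NonUnitalAlgebra.subset_adjoin ℂ rfl) hT), ?_⟩
    convert (hV.comp_V hTc (by fun_prop)).smul (n + 1 : ℝ) using 2 with u
    rw [integral_pow]
    have : (n + 1 : ℝ) ≠ 0 := by positivity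
    field_simp
    simp

lemma isC_poly {V : L2 →L[ℂ] L2} (hV : IsC V (fun _ => 1)) (p : Polynomial ℝ) :
    ∃ T ∈ NonUnitalAlgebra.adjoin ℂ {V}, IsC T (fun u => p.eval u) := by
  induction p using Polynomial.induction_on' with
  | add p q hp hq =>
    obtain ⟨S, hS, hSc⟩ := hp
    obtain ⟨T, hT, hTc⟩ := hq
    refine ⟨S + T, add_mem hS hT, ?_⟩
    simpa using hSc.add hTc p.continuous q.continuous
  | monomial n a =>
    obtain ⟨T, hT, hTc⟩ := isC_pow hV n
    exact ⟨(a : ℂ) • T, SMulMemClass.smul_mem _ hT, by simpa using hTc.smul a⟩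

lemma isC_mem {V T : L2 →L[ℂ] L2} (hV : IsC V (fun _ => 1)) {k : ℝ → ℝ} (hk : Continuous k)
    (hT : IsC T k) : T ∈ polyAlgV V := by
  refine Metric.mem_closure_iff.2 fun ε hε => ?_
  obtain ⟨p, hp⟩ := exists_polynomial_near_of_continuousOn 0 1 k hk.continuousOn (ε / 2)
    (by positivity)
  obtain ⟨P, hP, hPc⟩ := isC_poly hV p
  refine ⟨P, hP, ?_⟩
  rw [dist_comm, dist_eq_norm]
  have := (hPc.sub hT p.continuous hk).norm_le' (p.continuous.sub hk) (fun u hu => (hp u hu).le)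
  linarith

lemma isC_nilp {T : L2 →L[ℂ] L2} {k : ℝ → ℝ} {δ : ℝ} (hδ : 0 < δ)
    (hT : IsC T k) (h : ∀ u, u ≤ δ → k u = 0) : ∃ n : ℕ, 1 ≤ n ∧ T ^ n = 0 := by
  have key : ∀ (n : ℕ) (f : L2), ∀ᵐ x ∂μ01, x < n * δ → (T ^ n) f x = 0 := by
    intro n f
    induction n with
    | zero =>
      filter_upwards [ae_mem01] with x hx h
      simp at h
      linarith [hx.1]
    | succ n ih =>
      filter_upwards [hT ((T ^ n) f)] with x hx hlt
      rw [pow_succ', mul_apply_eq_comp, hx]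
      rw [integral_eq_zero_of_ae]
      filter_upwards [ih] with t ht
      by_cases htn : t < n * δ
      · rw [ht htn, mul_zero]; rfl
      · have : k (x - t) = 0 := h _ (by push_cast at hlt; linarith)
        simp [KK, this]
  obtain ⟨n, hn⟩ := exists_nat_gt (1 / δ)
  rw [div_lt_iff₀ hδ] at hn
  refine ⟨n, ?_, ?_⟩
  · rcases Nat.eq_zero_or_pos n with h0 | h0
    · subst h0; norm_num at hn
    · exact h0
  · ext1 f
    apply Lp.ext
    filter_upwards [key n f, ae_mem01, Lp.coeFn_zero ℂ 2 μ01] with x hx h1 h2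
    rw [hx (by linarith [h1.2])]
    exact h2.symm

lemma V_approx {V : L2 →L[ℂ] L2} (hV : IsC V (fun _ => 1)) {ε : ℝ} (hε : 0 < ε) :
    ∃ N ∈ polyAlgV V, (∃ n : ℕ, 1 ≤ n ∧ N ^ n = 0) ∧ ‖N - V‖ ≤ ε := by
  set δ : ℝ := ε ^ 2 / 2 with hδd
  have hδ : 0 < δ := by positivity
  set k : ℝ → ℝ := fun u => min 1 (max 0 ((u - δ) / δ)) with hkd
  have hk : Continuous k := by fun_prop
  obtain ⟨N, hN⟩ := exists_IsC hk
  refine ⟨N, isC_mem hV hk hN, isC_nilp hδ hN ?_, ?_⟩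
  · intro u hu
    have : (u - δ) / δ ≤ 0 := div_nonpos_of_nonpos_of_nonneg (by linarith) hδ.le
    simp [hkd, max_eq_left this]
  · refine (hN.sub hV hk continuous_const).norm_le (hk.sub continuous_const) hε.le fun x hx => ?_
    have hb : ∀ t, ‖KK (fun u => k u - 1) x t‖ ^ 2
        ≤ (Set.Icc (x - 2 * δ) x).indicator (fun _ => (1:ℝ)) t := by
      intro t
      unfold KK
      split_ifs with htx
      · by_cases h2 : x - 2 * δ ≤ t
        · have hmem : t ∈ Set.Icc (x - 2 * δ) x := ⟨h2, htx⟩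
          rw [Set.indicator_of_mem hmem, Complex.norm_real,
            Real.norm_eq_abs, sq_abs]
          change (k (x - t) - 1) ^ 2 ≤ 1
          have a1 : k (x - t) ≤ 1 := min_le_left _ _
          have a2 : 0 ≤ k (x - t) := le_min zero_le_one (le_max_left _ _)
          nlinarith
        · have a1 : 1 ≤ (x - t - δ) / δ := by
            rw [le_div_iff₀ hδ]; linarith
          have a2 : k (x - t) = 1 := min_eq_left (a1.trans (le_max_right _ _))
          simp only [a2]
          simpa using Set.indicator_nonneg (fun _ _ => zero_le_one) t
      · simpa using Set.indicator_nonneg (fun _ _ => zero_le_one) t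
    calc ∫ t, ‖KK (fun u => k u - 1) x t‖ ^ 2 ∂μ01
        ≤ ∫ t, (Set.Icc (x - 2 * δ) x).indicator (fun _ => (1:ℝ)) t ∂μ01 :=
          integral_mono_of_nonneg (ae_of_all _ fun _ => by positivity)
            ((integrable_const _).indicator measurableSet_Icc) (ae_of_all _ hb)
      _ = μ01.real (Set.Icc (x - 2 * δ) x) := by
          rw [integral_indicator measurableSet_Icc]; simp
      _ ≤ volume.real (Set.Icc (x - 2 * δ) x) := by
          refine ENNReal.toReal_mono measure_Icc_lt_top.ne ?_
          exact Measure.restrict_apply_le _ _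
      _ = ε ^ 2 := by
          rw [Real.volume_real_Icc_of_le (by linarith)]
          rw [hδd]; ring

open Polynomial in
lemma adjoin_poly {V P : L2 →L[ℂ] L2} (hP : P ∈ NonUnitalAlgebra.adjoin ℂ {V}) :
    ∃ p : ℂ[X], P = aeval V (p * X) := by
  induction hP using NonUnitalAlgebra.adjoin_induction with
  | mem x hx => exact ⟨1, by simpa using hx⟩
  | add x y hx hy h1 h2 =>
    obtain ⟨p, rfl⟩ := h1
    obtain ⟨q, rfl⟩ := h2
    exact ⟨p + q, by rw [add_mul, map_add]⟩
  | zero => exact ⟨0, by simp⟩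
  | mul x y hx hy h1 h2 =>
    obtain ⟨p, rfl⟩ := h1
    obtain ⟨q, rfl⟩ := h2
    exact ⟨p * X * q, by rw [← map_mul, mul_assoc (p * X)]⟩
  | smul r x hx h1 =>
    obtain ⟨p, rfl⟩ := h1
    exact ⟨r • p, by rw [smul_mul_assoc, map_smul]⟩

open Polynomial in
lemma aeval_mem {V N : L2 →L[ℂ] L2} (hN : N ∈ polyAlgV V) (p : ℂ[X]) :
    aeval N (p * X) ∈ polyAlgV V := by
  change aeval N (p * X) ∈ (NonUnitalAlgebra.adjoin ℂ {V}).topologicalClosure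
  replace hN : N ∈ (NonUnitalAlgebra.adjoin ℂ {V}).topologicalClosure := hN
  induction p using Polynomial.induction_on' with
  | add p q hp hq => rw [add_mul, map_add]; exact add_mem hp hq
  | monomial n a =>
    rw [monomial_mul_X, aeval_monomial, ← Algebra.smul_def]
    refine SMulMemClass.smul_mem _ ?_
    induction n with
    | zero => simpa using hN
    | succ n ih => rw [pow_succ]; exact mul_mem ih hN

/-- The nilpotent elements are dense in the Volterra operator algebra `A_V`. -/
theorem nilpotents_dense (V : L2 →L[ℂ] L2)
    (hV : ∀ ρ : L2, ∀ᵐ x ∂μ01, (V ρ) x = ∫ t in (0:ℝ)..x, ρ t) :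
    ∀ S ∈ polyAlgV V, ∀ ε : ℝ, 0 < ε →
      ∃ N ∈ polyAlgV V, ∃ n : ℕ, 1 ≤ n ∧ N ^ n = 0 ∧ ‖S - N‖ < ε := by
  intro S hS ε hε
  have hVc := isC_V hV
  obtain ⟨P, hP, hSP⟩ := Metric.mem_closure_iff.1 hS (ε / 2) (by positivity)
  obtain ⟨p, rfl⟩ := adjoin_poly hP
  have hcont := (p * Polynomial.X).continuous_aeval (A := L2 →L[ℂ] L2)
  obtain ⟨η, hη, hd⟩ := Metric.continuous_iff.1 hcont V (ε / 2) (by positivity)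
  obtain ⟨N, hN, ⟨n, hn, hNn⟩, hNV⟩ := V_approx hVc (half_pos hη)
  refine ⟨_, aeval_mem hN p, n, hn, ?_, ?_⟩
  · rw [← map_pow, mul_pow, map_mul, map_pow (Polynomial.aeval N) Polynomial.X,
      Polynomial.aeval_X, hNn, mul_zero]
  · have h1 := hd N (by rw [dist_eq_norm]; linarith)
    rw [← dist_eq_norm]
    have := dist_triangle_right S (Polynomial.aeval N (p * Polynomial.X))
      (Polynomial.aeval V (p * Polynomial.X))
    linarith
end
end
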